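/- Let x, y ∈ (0,1] and let f : [0,1]^2 → ℝ be twice continuously differentiable. Then the limit as n → ∞ of n · ( B_{n,2}^{[2]}f(x,y) - f(x,y) ) equals (x(1-x)/2) · ∂²f/∂x² (x,y) + (y(1-y)/2) · ∂²f/∂y² (x,y) - ((1-x)/2) · ∂f/∂x (x,y) - ((1-y)/2) · ∂f/∂y (x,y). -/

import Mathlib

open Filter Finset

/-- Bernstein basis polynomial `p_{n,k}(x) = C(n,k) x^k (1-x)^{n-k}`. -/
noncomputable def bern (n k : ℕ) (x : ℝ) : ℝ := (n.choose k : ℝ) * x ^ k * (1 - x) ^ (n - k)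

/-- The AKR node `t_{n,k} = √(k(k-1)/(n(n-1)))`. -/
noncomputable def akrNode (n k : ℕ) : ℝ := Real.sqrt ((k * (k - 1)) / (n * (n - 1)))

/-- The unit square `[0,1]²`. -/
def unitSquare : Set (ℝ × ℝ) := Set.Icc 0 1 ×ˢ Set.Icc 0 1

/-- Partial derivative in the first variable, taken within `[0,1]`. -/
noncomputable def pderivX (f : ℝ × ℝ → ℝ) (p : ℝ × ℝ) : ℝ :=
  derivWithin (fun s => f (s, p.2)) (Set.Icc 0 1) p.1

/-- Partial derivative in the second variable, taken within `[0,1]`. -/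
noncomputable def pderivY (f : ℝ × ℝ → ℝ) (p : ℝ × ℝ) : ℝ :=
  derivWithin (fun t => f (p.1, t)) (Set.Icc 0 1) p.2

/-- The bivariate tensor-product Bernstein operator
`B_n^{[2]} f(x,y) = Σ_{k=0}^n Σ_{l=0}^n f(k/n, l/n) p_{n,k}(x) p_{n,l}(y)`. -/
noncomputable def bernstein2Op (n : ℕ) (f : ℝ × ℝ → ℝ) (x y : ℝ) : ℝ :=
  ∑ k ∈ Finset.range (n + 1), ∑ l ∈ Finset.range (n + 1),
    f ((k : ℝ) / n, (l : ℝ) / n) * bern n k x * bern n l y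

/-- The bivariate Aldaz–Kounchev–Render operator with `j = 2`:
`B_{n,2}^{[2]} f(x,y) = Σ_{k=0}^n Σ_{l=0}^n f(t_{n,k}, t_{n,l}) p_{n,k}(x) p_{n,l}(y)`. -/
noncomputable def akr2Op (n : ℕ) (f : ℝ × ℝ → ℝ) (x y : ℝ) : ℝ :=
  ∑ k ∈ Finset.range (n + 1), ∑ l ∈ Finset.range (n + 1),
    f (akrNode n k, akrNode n l) * bern n k x * bern n l y

/-- The mean of `g` under the binomial weights `bern n k x`. -/
noncomputable def bernMean (n : ℕ) (x : ℝ) (g : ℕ → ℝ) : ℝ :=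
  ∑ k ∈ range (n + 1), g k * bern n k x

lemma bern_nonneg {x : ℝ} (hx : x ∈ Set.Icc (0 : ℝ) 1) (n k : ℕ) : 0 ≤ bern n k x := by
  have h0 := hx.1
  have h1 : 0 ≤ 1 - x := sub_nonneg.2 hx.2
  unfold bern
  positivity

lemma bern_zero_zero (x : ℝ) : bern 0 0 x = 1 := by simp [bern]

lemma bern_succ_zero (n : ℕ) (x : ℝ) : bern (n + 1) 0 x = (1 - x) * bern n 0 x := by
  simp [bern, pow_succ']

lemma bern_succ_succ (n k : ℕ) (x : ℝ) :
    bern (n + 1) (k + 1) x = (1 - x) * bern n (k + 1) x + x * bern n k x := by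
  unfold bern
  rw [Nat.choose_succ_succ, Nat.add_sub_add_right]
  rcases lt_or_ge k n with h | h
  · obtain ⟨d, rfl⟩ := Nat.exists_eq_add_of_lt h
    rw [show k + d + 1 - k = d + 1 by omega, show k + d + 1 - (k + 1) = d by omega]
    push_cast
    ring
  · rw [Nat.choose_eq_zero_of_lt (show n < k + 1 by omega)]
    push_cast
    ring

lemma bernMean_zero (x : ℝ) (g : ℕ → ℝ) : bernMean 0 x g = g 0 := by
  simp [bernMean, bern_zero_zero]

lemma bernMean_succ (n : ℕ) (x : ℝ) (g : ℕ → ℝ) :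
    bernMean (n + 1) x g = (1 - x) * bernMean n x g + x * bernMean n x (fun k => g (k + 1)) := by
  have htop : bern n (n + 1) x = 0 := by simp [bern]
  have h : ∑ k ∈ range (n + 1), g (k + 1) * bern n (k + 1) x + g 0 * bern n 0 x
      = bernMean n x g := by
    rw [← sum_range_succ' (fun k => g k * bern n k x), sum_range_succ, htop, mul_zero, add_zero,
      bernMean]
  rw [← h]
  unfold bernMean
  rw [sum_range_succ', bern_succ_zero, mul_add, mul_sum, mul_sum, add_right_comm,
    ← sum_add_distrib]
  congr 1
  · refine sum_congr rfl fun k _ => ?_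
    rw [bern_succ_succ]
    ring
  · ring

lemma bernMean_add (n : ℕ) (x : ℝ) (g h : ℕ → ℝ) :
    bernMean n x (fun k => g k + h k) = bernMean n x g + bernMean n x h := by
  simp only [bernMean, add_mul, sum_add_distrib]

lemma bernMean_const_mul (n : ℕ) (x c : ℝ) (g : ℕ → ℝ) :
    bernMean n x (fun k => c * g k) = c * bernMean n x g := by
  simp only [bernMean, mul_sum, mul_assoc]

lemma bernMean_mul_const (n : ℕ) (x c : ℝ) (g : ℕ → ℝ) :
    bernMean n x (fun k => g k * c) = bernMean n x g * c := by
  simp only [mul_comm _ c, bernMean_const_mul]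

lemma bernMean_mono {n : ℕ} {x : ℝ} (hx : x ∈ Set.Icc (0 : ℝ) 1) {g h : ℕ → ℝ}
    (hgh : ∀ k ≤ n, g k ≤ h k) : bernMean n x g ≤ bernMean n x h :=
  sum_le_sum fun k hk => mul_le_mul_of_nonneg_right
    (hgh k (Nat.lt_succ_iff.1 (mem_range.1 hk))) (bern_nonneg hx n k)

lemma bernMean_nonneg {n : ℕ} {x : ℝ} (hx : x ∈ Set.Icc (0 : ℝ) 1) {g : ℕ → ℝ}
    (hg : ∀ k, 0 ≤ g k) : 0 ≤ bernMean n x g :=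
  sum_nonneg fun k _ => mul_nonneg (hg k) (bern_nonneg hx n k)

lemma abs_bernMean_le {n : ℕ} {x : ℝ} (hx : x ∈ Set.Icc (0 : ℝ) 1) {g h : ℕ → ℝ}
    (hgh : ∀ k ≤ n, |g k| ≤ h k) : |bernMean n x g| ≤ bernMean n x h := by
  refine (abs_sum_le_sum_abs _ _).trans (sum_le_sum fun k hk => ?_)
  rw [abs_mul, abs_of_nonneg (bern_nonneg hx n k)]
  exact mul_le_mul_of_nonneg_right (hgh k (Nat.lt_succ_iff.1 (mem_range.1 hk)))
    (bern_nonneg hx n k)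

lemma bernMean_const (n : ℕ) (x c : ℝ) : bernMean n x (fun _ => c) = c := by
  induction n with
  | zero => exact bernMean_zero x _
  | succ n ih => rw [bernMean_succ, ih]; ring

/-- The mean of a quartic polynomial under the binomial distribution. -/
lemma bernMean_quartic (n : ℕ) (x a b c d e : ℝ) :
    bernMean n x (fun k => a + b * k + c * k ^ 2 + d * k ^ 3 + e * k ^ 4)
      = a + b * (n * x) + c * (n * x + n * (n - 1) * x ^ 2)
        + d * (n * x + 3 * (n * (n - 1)) * x ^ 2 + n * (n - 1) * (n - 2) * x ^ 3)
        + e * (n * x + 7 * (n * (n - 1)) * x ^ 2 + 6 * (n * (n - 1) * (n - 2)) * x ^ 3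
          + n * (n - 1) * (n - 2) * (n - 3) * x ^ 4) := by
  induction n generalizing a b c d e with
  | zero => simp [bernMean_zero]
  | succ n ih =>
    have hshift : (fun k : ℕ => a + b * ((k + 1 : ℕ) : ℝ) + c * ((k + 1 : ℕ) : ℝ) ^ 2
        + d * ((k + 1 : ℕ) : ℝ) ^ 3 + e * ((k + 1 : ℕ) : ℝ) ^ 4)
        = fun k : ℕ => (a + b + c + d + e) + (b + 2 * c + 3 * d + 4 * e) * (k : ℝ)
          + (c + 3 * d + 6 * e) * (k : ℝ) ^ 2 + (d + 4 * e) * (k : ℝ) ^ 3 + e * (k : ℝ) ^ 4 := by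
      funext k
      push_cast
      ring
    rw [bernMean_succ, ih, hshift, ih]
    push_cast
    ring

lemma bernMean_fourth_central_le {n : ℕ} (hn : 1 ≤ n) {x : ℝ} (hx : x ∈ Set.Icc (0 : ℝ) 1) :
    bernMean n x (fun k => ((k : ℝ) / n - x) ^ 4) ≤ 1 / (n : ℝ) ^ 2 := by
  have hn' : (1 : ℝ) ≤ n := by exact_mod_cast hn
  have hn0 : (n : ℝ) ≠ 0 := by positivity
  have h : bernMean n x (fun k => ((k : ℝ) / n - x) ^ 4)
      = x * (1 - x) * (1 + 3 * (n - 2) * (x * (1 - x))) / (n : ℝ) ^ 3 := by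
    rw [show (fun k : ℕ => ((k : ℝ) / n - x) ^ 4) = fun k : ℕ => x ^ 4
        + (-4 * x ^ 3 / n) * (k : ℝ) + (6 * x ^ 2 / n ^ 2) * (k : ℝ) ^ 2
        + (-4 * x / n ^ 3) * (k : ℝ) ^ 3 + (1 / n ^ 4) * (k : ℝ) ^ 4 by
      funext k; field_simp; ring, bernMean_quartic]
    field_simp
    ring
  have hq0 : 0 ≤ x * (1 - x) := mul_nonneg hx.1 (sub_nonneg.2 hx.2)
  have hq1 : x * (1 - x) ≤ 1 / 4 := by nlinarith [sq_nonneg (x - 1 / 2)]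
  rw [h, div_le_div_iff₀ (by positivity) (by positivity)]
  have key : x * (1 - x) * (1 + 3 * (n - 2) * (x * (1 - x))) ≤ n := by
    generalize x * (1 - x) = q at hq0 hq1
    nlinarith [mul_nonneg hq0 hq0, mul_nonneg hq0 (sub_nonneg.2 hq1),
      mul_nonneg (mul_nonneg hq0 (sub_nonneg.2 hq1)) (sub_nonneg.2 hn')]
  calc _ ≤ (n : ℝ) * (n : ℝ) ^ 2 := by gcongr
    _ = _ := by ring

lemma akrNode_sq {n k : ℕ} (hn : 2 ≤ n) :
    akrNode n k ^ 2 = ((k : ℝ) ^ 2 - k) / (n * (n - 1)) := by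
  have hn' : (2 : ℝ) ≤ n := by exact_mod_cast hn
  have hk : (0 : ℝ) ≤ k * (k - 1) := by
    rcases Nat.eq_zero_or_pos k with rfl | h
    · simp
    · exact mul_nonneg (by positivity) (sub_nonneg.2 (by exact_mod_cast h))
  rw [akrNode, Real.sq_sqrt (div_nonneg hk (mul_nonneg (by linarith) (by linarith)))]
  ring

lemma akrNode_nonneg (n k : ℕ) : 0 ≤ akrNode n k := Real.sqrt_nonneg _

lemma abs_akrNode_sq_sub_le {n k : ℕ} (hn : 2 ≤ n) (hk : k ≤ n) :
    |akrNode n k ^ 2 - ((k : ℝ) / n) ^ 2| ≤ 2 / n := by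
  have hn' : (2 : ℝ) ≤ n := by exact_mod_cast hn
  have hk' : (k : ℝ) ≤ n := by exact_mod_cast hk
  have hk0 : (0 : ℝ) ≤ k := by positivity
  have h1 : (0 : ℝ) < n - 1 := by linarith
  rw [akrNode_sq hn, show ((k : ℝ) ^ 2 - k) / (n * (n - 1)) - ((k : ℝ) / n) ^ 2
    = -(k * (n - k) / (n ^ 2 * (n - 1))) by field_simp; ring, abs_neg,
    abs_of_nonneg (div_nonneg (mul_nonneg hk0 (sub_nonneg.2 hk')) (by positivity)),
    div_le_div_iff₀ (by positivity) (by positivity)]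
  have : (k : ℝ) * (n - k) ≤ n ^ 2 := by nlinarith
  nlinarith [mul_le_mul_of_nonneg_right this (show (0 : ℝ) ≤ n by linarith),
    mul_nonneg (sq_nonneg (n : ℝ)) (show (0 : ℝ) ≤ n - 2 by linarith)]

lemma akrNode_mem_Icc {n k : ℕ} (hn : 2 ≤ n) (hk : k ≤ n) : akrNode n k ∈ Set.Icc (0 : ℝ) 1 := by
  have hn' : (2 : ℝ) ≤ n := by exact_mod_cast hn
  have hk' : (k : ℝ) ≤ n := by exact_mod_cast hk
  refine ⟨akrNode_nonneg n k, ?_⟩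
  rw [← sq_le_one_iff₀ (akrNode_nonneg n k), akrNode_sq hn,
    div_le_one (mul_pos (by linarith) (by linarith))]
  rcases Nat.eq_zero_or_pos k with rfl | h
  · nlinarith
  · have : (1 : ℝ) ≤ k := by exact_mod_cast h
    nlinarith

lemma bernMean_akrNode_sq {n : ℕ} (hn : 2 ≤ n) (x : ℝ) :
    bernMean n x (fun k => akrNode n k ^ 2 - x ^ 2) = 0 := by
  have hn' : (2 : ℝ) ≤ n := by exact_mod_cast hn
  have h0 : (n : ℝ) ≠ 0 := by linarith
  have h1 : (n : ℝ) - 1 ≠ 0 := by linarith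
  rw [show (fun k : ℕ => akrNode n k ^ 2 - x ^ 2) = fun k : ℕ => -x ^ 2
      + (-1 / (n * (n - 1))) * (k : ℝ) + (1 / (n * (n - 1))) * (k : ℝ) ^ 2 + 0 * (k : ℝ) ^ 3
      + 0 * (k : ℝ) ^ 4 by funext k; rw [akrNode_sq hn]; ring, bernMean_quartic]
  field_simp
  ring

lemma bernMean_akrNode_sq_sub_sq {n : ℕ} (hn : 2 ≤ n) (x : ℝ) :
    n * bernMean n x (fun k => (akrNode n k ^ 2 - x ^ 2) ^ 2)
      = 4 * x ^ 3 * (1 - x) + 2 * x ^ 2 * (1 - x) ^ 2 / (n - 1) := by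
  have hn' : (2 : ℝ) ≤ n := by exact_mod_cast hn
  have h0 : (n : ℝ) ≠ 0 := by linarith
  have h1 : (n : ℝ) - 1 ≠ 0 := by linarith
  rw [show (fun k : ℕ => (akrNode n k ^ 2 - x ^ 2) ^ 2) = fun k : ℕ => x ^ 4
      + (2 * x ^ 2 / (n * (n - 1))) * (k : ℝ)
      + (1 / (n * (n - 1)) ^ 2 - 2 * x ^ 2 / (n * (n - 1))) * (k : ℝ) ^ 2
      + (-2 / (n * (n - 1)) ^ 2) * (k : ℝ) ^ 3
      + (1 / (n * (n - 1)) ^ 2) * (k : ℝ) ^ 4 by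
    funext k
    rw [akrNode_sq hn]
    field_simp
    ring, bernMean_quartic]
  field_simp
  ring

lemma bernMean_akrNode_sub_fourth_le {n : ℕ} (hn : 2 ≤ n) {x : ℝ} (hx : x ∈ Set.Ioc (0 : ℝ) 1) :
    n * bernMean n x (fun k => (akrNode n k - x) ^ 4) ≤ 256 / x ^ 4 / n := by
  have hxI : x ∈ Set.Icc (0 : ℝ) 1 := ⟨hx.1.le, hx.2⟩
  have hx0 := hx.1
  have hn' : (2 : ℝ) ≤ n := by exact_mod_cast hn
  have hpt : ∀ k ≤ n, (akrNode n k - x) ^ 4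
      ≤ 128 / x ^ 4 * (1 / (n : ℝ) ^ 4 + ((k : ℝ) / n - x) ^ 4) := by
    intro k hk
    have ht := akrNode_mem_Icc hn hk
    have hd := abs_akrNode_sq_sub_le hn hk
    have hr0 : (0 : ℝ) ≤ (k : ℝ) / n := by positivity
    have hr1 : (k : ℝ) / n ≤ 1 := div_le_one_of_le₀ (by exact_mod_cast hk) (by positivity)
    set t := akrNode n k
    set r := (k : ℝ) / n
    have h1 : x * |t - x| ≤ 2 * (1 / n + |r - x|) := by
      calc x * |t - x| ≤ (t + x) * |t - x| := by gcongr; linarith [ht.1]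
        _ = |t ^ 2 - x ^ 2| := by
          rw [sq_sub_sq, abs_mul, abs_of_nonneg (show 0 ≤ t + x by linarith [ht.1])]
        _ = |(t ^ 2 - r ^ 2) + (r + x) * (r - x)| := by congr 1; ring
        _ ≤ |t ^ 2 - r ^ 2| + |(r + x) * (r - x)| := abs_add_le _ _
        _ ≤ 2 / n + 2 * |r - x| := by
          rw [abs_mul, abs_of_nonneg (show 0 ≤ r + x by linarith)]
          gcongr
          linarith [hx.2]
        _ = _ := by ring
    have h2 : (x * |t - x|) ^ 4 ≤ 16 * (8 * ((1 / (n : ℝ)) ^ 4 + |r - x| ^ 4)) := by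
      calc _ ≤ (2 * (1 / (n : ℝ) + |r - x|)) ^ 4 := by gcongr
        _ = 16 * (1 / (n : ℝ) + |r - x|) ^ 4 := by ring
        _ ≤ _ := by
          gcongr
          have := add_pow_le (show (0 : ℝ) ≤ 1 / n by positivity) (abs_nonneg (r - x)) 4
          norm_num at this ⊢
          exact this
    rw [mul_pow, (show Even 4 by decide).pow_abs, (show Even 4 by decide).pow_abs, one_div_pow]
      at h2
    rw [div_mul_eq_mul_div, le_div_iff₀ (by positivity)]
    linarith
  have h := bernMean_mono hxI hpt
  rw [bernMean_const_mul, bernMean_add, bernMean_const] at h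
  have h4 := bernMean_fourth_central_le (show 1 ≤ n by omega) hxI
  calc _ ≤ n * (128 / x ^ 4 * (1 / (n : ℝ) ^ 4 + 1 / (n : ℝ) ^ 2)) := by
        gcongr
        exact h.trans (by gcongr)
    _ ≤ n * (128 / x ^ 4 * (1 / (n : ℝ) ^ 2 + 1 / (n : ℝ) ^ 2)) := by
        gcongr <;> linarith
    _ = _ := by field_simp; ring

lemma tendsto_bernMean_akrNode_sub_fourth {x : ℝ} (hx : x ∈ Set.Ioc (0 : ℝ) 1) :
    Tendsto (fun n : ℕ => n * bernMean n x (fun k => (akrNode n k - x) ^ 4)) atTop (nhds 0) := by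
  have hxI : x ∈ Set.Icc (0 : ℝ) 1 := ⟨hx.1.le, hx.2⟩
  refine squeeze_zero' (Eventually.of_forall fun n => ?_) ?_
    (tendsto_const_div_atTop_nhds_zero_nat (256 / x ^ 4))
  · exact mul_nonneg (by positivity) (bernMean_nonneg hxI fun k => by positivity)
  · filter_upwards [eventually_ge_atTop 2] with n hn
    exact bernMean_akrNode_sub_fourth_le hn hx

lemma tendsto_bernMean_akrNode_sq_sub_sq (x : ℝ) :
    Tendsto (fun n : ℕ => n * bernMean n x (fun k => (akrNode n k ^ 2 - x ^ 2) ^ 2)) atTop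
      (nhds (4 * x ^ 3 * (1 - x))) := by
  have h : Tendsto (fun n : ℕ => 4 * x ^ 3 * (1 - x) + 2 * x ^ 2 * (1 - x) ^ 2 / ((n : ℝ) - 1))
      atTop (nhds (4 * x ^ 3 * (1 - x) + 0)) :=
    tendsto_const_nhds.add (tendsto_const_nhds.div_atTop
      (tendsto_atTop_add_const_right _ _ tendsto_natCast_atTop_atTop))
  rw [add_zero] at h
  refine h.congr' ?_
  filter_upwards [eventually_ge_atTop 2] with n hn
  exact (bernMean_akrNode_sq_sub_sq hn x).symm

lemma tendsto_bernMean_akrNode_sub_cube {x : ℝ} (hx : x ∈ Set.Ioc (0 : ℝ) 1) :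
    Tendsto (fun n : ℕ => n * bernMean n x (fun k => (akrNode n k - x) ^ 3)) atTop (nhds 0) := by
  have hxI : x ∈ Set.Icc (0 : ℝ) 1 := ⟨hx.1.le, hx.2⟩
  have hx0 := hx.1
  have hlim := ((tendsto_bernMean_akrNode_sq_sub_sq x).const_mul (1 / x ^ 2)).mul
    (tendsto_bernMean_akrNode_sub_fourth hx)
  rw [mul_zero] at hlim
  have hsq : Tendsto (fun n : ℕ => (n * bernMean n x (fun k => (akrNode n k - x) ^ 3)) ^ 2) atTop
      (nhds 0) := by
    refine squeeze_zero (fun n => sq_nonneg _) (fun n => ?_) hlim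
    have hcs : bernMean n x (fun k => (akrNode n k - x) ^ 3) ^ 2
        ≤ bernMean n x (fun k => (akrNode n k - x) ^ 2)
          * bernMean n x (fun k => (akrNode n k - x) ^ 4) :=
      sum_sq_le_sum_mul_sum_of_sq_le_mul _
        (fun k _ => mul_nonneg (by positivity) (bern_nonneg hxI n k))
        (fun k _ => mul_nonneg (by positivity) (bern_nonneg hxI n k)) (fun k _ => le_of_eq (by ring))
    have hle : bernMean n x (fun k => (akrNode n k - x) ^ 2)
        ≤ 1 / x ^ 2 * bernMean n x (fun k => (akrNode n k ^ 2 - x ^ 2) ^ 2) := by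
      rw [← bernMean_const_mul]
      refine bernMean_mono hxI fun k _ => ?_
      have ht := akrNode_nonneg n k
      rw [one_div_mul_eq_div, le_div_iff₀ (by positivity), sq_sub_sq, mul_pow, mul_comm]
      gcongr
      linarith
    have h4 : 0 ≤ bernMean n x (fun k => (akrNode n k - x) ^ 4) :=
      bernMean_nonneg hxI fun k => by positivity
    calc _ = (n : ℝ) ^ 2 * bernMean n x (fun k => (akrNode n k - x) ^ 3) ^ 2 := by ring
      _ ≤ (n : ℝ) ^ 2 * (1 / x ^ 2 * bernMean n x (fun k => (akrNode n k ^ 2 - x ^ 2) ^ 2)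
          * bernMean n x (fun k => (akrNode n k - x) ^ 4)) := by
        gcongr
        exact hcs.trans (by gcongr)
      _ = _ := by ring
  have habs := hsq.sqrt
  simp only [Real.sqrt_sq_eq_abs, Real.sqrt_zero] at habs
  exact (tendsto_zero_iff_abs_tendsto_zero _).2 habs

lemma tendsto_bernMean_akrNode_sub_sq {x : ℝ} (hx : x ∈ Set.Ioc (0 : ℝ) 1) :
    Tendsto (fun n : ℕ => n * bernMean n x (fun k => (akrNode n k - x) ^ 2)) atTop
      (nhds (x * (1 - x))) := by
  have hx0 := hx.1
  have hlim := (((tendsto_bernMean_akrNode_sq_sub_sq x).const_mul (1 / (4 * x ^ 2))).add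
    ((tendsto_bernMean_akrNode_sub_cube hx).const_mul (-1 / x))).add
    ((tendsto_bernMean_akrNode_sub_fourth hx).const_mul (-1 / (4 * x ^ 2)))
  have hval : 1 / (4 * x ^ 2) * (4 * x ^ 3 * (1 - x)) + -1 / x * 0 + -1 / (4 * x ^ 2) * 0
      = x * (1 - x) := by
    field_simp
    ring
  rw [hval] at hlim
  refine hlim.congr fun n => ?_
  have hfun : (fun k => (akrNode n k - x) ^ 2)
      = fun k => 1 / (4 * x ^ 2) * (akrNode n k ^ 2 - x ^ 2) ^ 2
        + -1 / x * (akrNode n k - x) ^ 3 + -1 / (4 * x ^ 2) * (akrNode n k - x) ^ 4 := by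
    funext k
    field_simp
    ring
  rw [hfun]
  simp only [bernMean_add, bernMean_const_mul]
  ring

lemma tendsto_bernMean_akrNode_sub {x : ℝ} (hx : x ∈ Set.Ioc (0 : ℝ) 1) :
    Tendsto (fun n : ℕ => n * bernMean n x (fun k => akrNode n k - x)) atTop
      (nhds (-((1 - x) / 2))) := by
  have hx0 := hx.1
  have hlim := (tendsto_bernMean_akrNode_sub_sq hx).const_mul (-1 / (2 * x))
  rw [show -1 / (2 * x) * (x * (1 - x)) = -((1 - x) / 2) by field_simp] at hlim
  refine hlim.congr' ?_
  filter_upwards [eventually_ge_atTop 2] with n hn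
  have hfun : (fun k => akrNode n k - x)
      = fun k => 1 / (2 * x) * (akrNode n k ^ 2 - x ^ 2)
        + -1 / (2 * x) * (akrNode n k - x) ^ 2 := by
    funext k
    field_simp
    ring
  rw [hfun, bernMean_add, bernMean_const_mul, bernMean_const_mul, bernMean_akrNode_sq hn]
  ring

/-- Second order Taylor expansion with Peano remainder on a convex set. -/
lemma isLittleO_taylor_two {E : Type*} [NormedAddCommGroup E] [NormedSpace ℝ E] {S : Set E}
    (hS : Convex ℝ S) {f : E → ℝ} {f' : E → E →L[ℝ] ℝ} {L : E →L[ℝ] E →L[ℝ] ℝ} {p : E}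
    (hp : p ∈ S) (hf : ∀ q ∈ S, HasFDerivWithinAt f (f' q) S q)
    (hf' : HasFDerivWithinAt f' L S p) :
    (fun q => f q - (f p + f' p (q - p) + 1 / 2 * L (q - p) (q - p)))
      =o[nhdsWithin p S] fun q => ‖q - p‖ ^ 2 := by
  rw [Asymptotics.isLittleO_iff]
  intro ε hε
  have h := (Asymptotics.isLittleO_iff.1 hf'.isLittleO) hε
  obtain ⟨δ, hδ, hball⟩ := Metric.mem_nhdsWithin_iff.1 h
  filter_upwards [inter_mem_nhdsWithin S (Metric.ball_mem_nhds p hδ)] with q hq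
  set v := q - p with hv
  have hmem : ∀ r ∈ Set.Icc (0 : ℝ) 1, p + r • v ∈ S := fun r hr =>
    hS.add_smul_sub_mem hp hq.1 hr
  have hnorm : ∀ r ∈ Set.Icc (0 : ℝ) 1, ‖r • v‖ ≤ ‖v‖ := fun r hr => by
    rw [norm_smul, Real.norm_of_nonneg hr.1]
    exact mul_le_of_le_one_left (norm_nonneg _) hr.2
  have hderiv : ∀ r ∈ Set.Icc (0 : ℝ) 1, HasDerivWithinAt
      (fun r : ℝ => f (p + r • v) - (r * f' p v + r ^ 2 / 2 * L v v))
      (f' (p + r • v) v - (f' p v + r * L v v)) (Set.Icc 0 1) r := by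
    intro r hr
    have hline : HasDerivWithinAt (fun r : ℝ => p + r • v) v (Set.Icc 0 1) r := by
      simpa using (((hasDerivAt_id r).smul_const v).const_add p).hasDerivWithinAt
    have h1 := (hf _ (hmem r hr)).comp_hasDerivWithinAt r hline hmem
    have h2 : HasDerivWithinAt (fun r : ℝ => r * f' p v + r ^ 2 / 2 * L v v)
        (f' p v + r * L v v) (Set.Icc 0 1) r := by
      have := (((hasDerivAt_id r).mul_const (f' p v)).add
        ((((hasDerivAt_id r).pow 2).div_const 2).mul_const (L v v))).hasDerivWithinAt
        (s := Set.Icc 0 1)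
      exact this.congr_deriv (by simp)
    exact h1.sub h2
  have hbound : ∀ r ∈ Set.Ico (0 : ℝ) 1,
      ‖f' (p + r • v) v - (f' p v + r * L v v)‖ ≤ ε * ‖v‖ ^ 2 := by
    intro r hr
    have hr' := Set.Ico_subset_Icc_self hr
    have hin : p + r • v ∈ Metric.ball p δ ∩ S := by
      refine ⟨?_, hmem r hr'⟩
      have hqv : ‖v‖ < δ := by simpa [dist_eq_norm] using hq.2
      simpa [dist_eq_norm] using (hnorm r hr').trans_lt hqv
    have hb : ‖f' (p + r • v) - f' p - L (p + r • v - p)‖ ≤ ε * ‖p + r • v - p‖ := hball hin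
    rw [add_sub_cancel_left] at hb
    calc _ = ‖(f' (p + r • v) - f' p - L (r • v)) v‖ := by
          congr 1
          simp
          ring
      _ ≤ ‖f' (p + r • v) - f' p - L (r • v)‖ * ‖v‖ := ContinuousLinearMap.le_opNorm _ _
      _ ≤ ε * ‖v‖ * ‖v‖ := by
          gcongr
          exact hb.trans (by gcongr; exact hnorm r hr')
      _ = _ := by ring
  have hmv := norm_image_sub_le_of_norm_deriv_le_segment_01' hderiv hbound
  rw [Real.norm_of_nonneg (sq_nonneg ‖v‖)]
  have hval : f q - (f p + f' p v + 1 / 2 * L v v) = f (p + (1 : ℝ) • v)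
      - (1 * f' p v + 1 ^ 2 / 2 * L v v)
      - (f (p + (0 : ℝ) • v) - (0 * f' p v + 0 ^ 2 / 2 * L v v)) := by
    rw [one_smul, zero_smul, add_zero, show p + v = q from add_sub_cancel p q]
    ring
  rw [hval]
  exact hmv

lemma abs_sub_taylor_two_le {E : Type*} [NormedAddCommGroup E] [NormedSpace ℝ E] {S : Set E}
    (hS : Convex ℝ S) (hSc : IsCompact S) {f : E → ℝ} {f' : E → E →L[ℝ] ℝ}
    {L : E →L[ℝ] E →L[ℝ] ℝ} {p : E} (hp : p ∈ S) (hf : ∀ q ∈ S, HasFDerivWithinAt f (f' q) S q)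
    (hf' : HasFDerivWithinAt f' L S p) {ε : ℝ} (hε : 0 < ε) :
    ∃ M, 0 ≤ M ∧ ∀ q ∈ S, |f q - (f p + f' p (q - p) + 1 / 2 * L (q - p) (q - p))|
      ≤ ε * ‖q - p‖ ^ 2 + M * ‖q - p‖ ^ 4 := by
  have hloc := (Asymptotics.isLittleO_iff.1 (isLittleO_taylor_two hS hp hf hf')) hε
  obtain ⟨δ, hδ, hball⟩ := Metric.mem_nhdsWithin_iff.1 hloc
  have hcont : ContinuousOn (fun q => f q - (f p + f' p (q - p) + 1 / 2 * L (q - p) (q - p))) S := by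
    have hfc : ContinuousOn f S := fun q hq => (hf q hq).continuousWithinAt
    refine hfc.sub (Continuous.continuousOn ?_)
    fun_prop
  obtain ⟨K, hK⟩ := hSc.exists_bound_of_continuousOn hcont
  have hK0 : 0 ≤ K := (norm_nonneg _).trans (hK p hp)
  refine ⟨K / δ ^ 4, by positivity, fun q hq => ?_⟩
  rcases lt_or_ge ‖q - p‖ δ with h | h
  · have hb : ‖f q - (f p + f' p (q - p) + 1 / 2 * L (q - p) (q - p))‖ ≤ ε * ‖‖q - p‖ ^ 2‖ :=
      hball ⟨by simpa [dist_eq_norm] using h, hq⟩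
    rw [Real.norm_of_nonneg (sq_nonneg ‖q - p‖)] at hb
    exact hb.trans (le_add_of_nonneg_right (by positivity))
  · have h1 : K ≤ K / δ ^ 4 * ‖q - p‖ ^ 4 := by
      rw [div_mul_eq_mul_div, le_div_iff₀ (by positivity)]
      gcongr
    exact (hK q hq).trans (h1.trans (le_add_of_nonneg_left (by positivity)))

lemma convex_unitSquare : Convex ℝ unitSquare := (convex_Icc 0 1).prod (convex_Icc 0 1)

lemma isCompact_unitSquare : IsCompact unitSquare := isCompact_Icc.prod isCompact_Icc

lemma uniqueDiffOn_unitSquare : UniqueDiffOn ℝ unitSquare :=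
  (uniqueDiffOn_Icc zero_lt_one).prod (uniqueDiffOn_Icc zero_lt_one)

lemma HasFDerivWithinAt.derivWithin_fst {F : Type*} [NormedAddCommGroup F] [NormedSpace ℝ F]
    {g : ℝ × ℝ → F} {g' : ℝ × ℝ →L[ℝ] F} {s t : ℝ} (hg : HasFDerivWithinAt g g' unitSquare (s, t))
    (hs : s ∈ Set.Icc (0 : ℝ) 1) (ht : t ∈ Set.Icc (0 : ℝ) 1) :
    derivWithin (fun r => g (r, t)) (Set.Icc 0 1) s = g' (1, 0) := by
  have hline : HasDerivWithinAt (fun r : ℝ => (r, t)) ((1, 0) : ℝ × ℝ) (Set.Icc 0 1) s :=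
    (hasDerivWithinAt_id _ _).prodMk (hasDerivWithinAt_const _ _ _)
  have hmaps : Set.MapsTo (fun r : ℝ => (r, t)) (Set.Icc 0 1) unitSquare := fun r hr => ⟨hr, ht⟩
  exact (hg.comp_hasDerivWithinAt s hline hmaps).derivWithin
    (uniqueDiffOn_Icc zero_lt_one s hs)

lemma HasFDerivWithinAt.derivWithin_snd {F : Type*} [NormedAddCommGroup F] [NormedSpace ℝ F]
    {g : ℝ × ℝ → F} {g' : ℝ × ℝ →L[ℝ] F} {s t : ℝ} (hg : HasFDerivWithinAt g g' unitSquare (s, t))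
    (hs : s ∈ Set.Icc (0 : ℝ) 1) (ht : t ∈ Set.Icc (0 : ℝ) 1) :
    derivWithin (fun r => g (s, r)) (Set.Icc 0 1) t = g' (0, 1) := by
  have hline : HasDerivWithinAt (fun r : ℝ => (s, r)) ((0, 1) : ℝ × ℝ) (Set.Icc 0 1) t :=
    (hasDerivWithinAt_const _ _ _).prodMk (hasDerivWithinAt_id _ _)
  have hmaps : Set.MapsTo (fun r : ℝ => (s, r)) (Set.Icc 0 1) unitSquare := fun r hr => ⟨hs, hr⟩
  exact (hg.comp_hasDerivWithinAt t hline hmaps).derivWithin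
    (uniqueDiffOn_Icc zero_lt_one t ht)

lemma exists_taylor_two_unitSquare {f : ℝ × ℝ → ℝ} (hf : ContDiffOn ℝ 2 f unitSquare) {x y : ℝ}
    (hx : x ∈ Set.Icc (0 : ℝ) 1) (hy : y ∈ Set.Icc (0 : ℝ) 1) :
    ∃ c : ℝ, ∀ ε > 0, ∃ M, 0 ≤ M ∧ ∀ s ∈ Set.Icc (0 : ℝ) 1, ∀ t ∈ Set.Icc (0 : ℝ) 1,
      |f (s, t) - (f (x, y) + pderivX f (x, y) * (s - x) + pderivY f (x, y) * (t - y)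
        + pderivX (pderivX f) (x, y) / 2 * (s - x) ^ 2
        + pderivY (pderivY f) (x, y) / 2 * (t - y) ^ 2 + c * ((s - x) * (t - y)))|
      ≤ ε * ((s - x) ^ 2 + (t - y) ^ 2) + M * ((s - x) ^ 4 + (t - y) ^ 4) := by
  set f' := fderivWithin ℝ f unitSquare
  have hp : ((x, y) : ℝ × ℝ) ∈ unitSquare := ⟨hx, hy⟩
  have hd : ∀ q ∈ unitSquare, HasFDerivWithinAt f (f' q) unitSquare q := fun q hq =>
    (hf.differentiableOn (by norm_num) q hq).hasFDerivWithinAt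
  have hd' : HasFDerivWithinAt f' (fderivWithin ℝ f' unitSquare (x, y)) unitSquare (x, y) :=
    ((hf.fderivWithin uniqueDiffOn_unitSquare (m := 1) (by norm_num)).differentiableOn
      (by norm_num) _ hp).hasFDerivWithinAt
  set L := fderivWithin ℝ f' unitSquare (x, y)
  have hX : ∀ s ∈ Set.Icc (0 : ℝ) 1, ∀ t ∈ Set.Icc (0 : ℝ) 1, pderivX f (s, t) = f' (s, t) (1, 0) :=
    fun s hs t ht => (hd (s, t) ⟨hs, ht⟩).derivWithin_fst hs ht
  have hY : ∀ s ∈ Set.Icc (0 : ℝ) 1, ∀ t ∈ Set.Icc (0 : ℝ) 1, pderivY f (s, t) = f' (s, t) (0, 1) :=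
    fun s hs t ht => (hd (s, t) ⟨hs, ht⟩).derivWithin_snd hs ht
  have hXX : pderivX (pderivX f) (x, y) = L (1, 0) (1, 0) := by
    have h1 : HasFDerivWithinAt (fun q => f' q (1, 0)) _ unitSquare (x, y) :=
      hd'.clm_apply (hasFDerivWithinAt_const ((1, 0) : ℝ × ℝ) _ _)
    have h2 := h1.derivWithin_fst hx hy
    rw [pderivX, derivWithin_congr (fun s hs => hX s hs y hy) (hX x hx y hy), h2]
    simp
  have hYY : pderivY (pderivY f) (x, y) = L (0, 1) (0, 1) := by
    have h1 : HasFDerivWithinAt (fun q => f' q (0, 1)) _ unitSquare (x, y) :=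
      hd'.clm_apply (hasFDerivWithinAt_const ((0, 1) : ℝ × ℝ) _ _)
    have h2 := h1.derivWithin_snd hx hy
    rw [pderivY, derivWithin_congr (fun t ht => hY x hx t ht) (hY x hx y hy), h2]
    simp
  refine ⟨(L (1, 0) (0, 1) + L (0, 1) (1, 0)) / 2, fun ε hε => ?_⟩
  obtain ⟨M, hM, hbound⟩ :=
    abs_sub_taylor_two_le convex_unitSquare isCompact_unitSquare hp hd hd' hε
  refine ⟨M, hM, fun s hs t ht => ?_⟩
  have hdecomp : ((s, t) : ℝ × ℝ) - (x, y)
      = (s - x) • ((1, 0) : ℝ × ℝ) + (t - y) • ((0, 1) : ℝ × ℝ) := by simp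
  have hb := hbound (s, t) ⟨hs, ht⟩
  have hnorm : ∀ m : ℕ, Even m → ‖((s, t) : ℝ × ℝ) - (x, y)‖ ^ m ≤ (s - x) ^ m + (t - y) ^ m := by
    intro m hm
    rw [Prod.mk_sub_mk, Prod.norm_mk, Real.norm_eq_abs, Real.norm_eq_abs]
    rcases max_choice |s - x| |t - y| with h | h <;> rw [h, hm.pow_abs]
    · exact le_add_of_nonneg_right (hm.pow_nonneg _)
    · exact le_add_of_nonneg_left (hm.pow_nonneg _)
  have h2 := hnorm 2 (by decide)
  have h4 := hnorm 4 (by decide)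
  refine le_trans (le_of_eq ?_) (hb.trans (by gcongr))
  rw [hdecomp, hX x hx y hy, hY x hx y hy, hXX, hYY]
  simp only [map_add, map_smul, _root_.add_apply, _root_.smul_apply,
    smul_eq_mul]
  congr 1
  ring

lemma akr2Op_eq_bernMean (n : ℕ) (f : ℝ × ℝ → ℝ) (x y : ℝ) :
    akr2Op n f x y
      = bernMean n x (fun k => bernMean n y (fun l => f (akrNode n k, akrNode n l))) := by
  unfold akr2Op bernMean
  refine sum_congr rfl fun k _ => ?_
  rw [sum_mul]
  exact sum_congr rfl fun l _ => by ring

lemma tendsto_zero_of_abs_le_eps_mul_add {ρ V W : ℕ → ℝ} {v : ℝ} (hv : 0 ≤ v)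
    (hV : Tendsto V atTop (nhds v)) (hW : Tendsto W atTop (nhds 0))
    (h : ∀ ε > 0, ∃ M, ∀ᶠ n in atTop, |ρ n| ≤ ε * V n + M * W n) :
    Tendsto ρ atTop (nhds 0) := by
  rw [Metric.tendsto_nhds]
  intro η hη
  obtain ⟨M, hM⟩ := h (η / (v + 1)) (by positivity)
  have hlim := (hV.const_mul (η / (v + 1))).add (hW.const_mul M)
  have hlt : η / (v + 1) * v + M * 0 < η := by
    rw [mul_zero, add_zero, div_mul_eq_mul_div, div_lt_iff₀ (by positivity)]
    linarith
  filter_upwards [hM, hlim.eventually_lt_const hlt] with n h1 h2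
  rw [Real.dist_eq, sub_zero]
  exact h1.trans_lt h2

theorem stmt_13 (x y : ℝ) (hx : x ∈ Set.Ioc (0 : ℝ) 1) (hy : y ∈ Set.Ioc (0 : ℝ) 1)
    (f : ℝ × ℝ → ℝ) (hf : ContDiffOn ℝ 2 f unitSquare) :
    Tendsto (fun n : ℕ => (n : ℝ) * (akr2Op n f x y - f (x, y))) atTop
      (nhds (x * (1 - x) / 2 * pderivX (pderivX f) (x, y)
        + y * (1 - y) / 2 * pderivY (pderivY f) (x, y)
        - (1 - x) / 2 * pderivX f (x, y)
        - (1 - y) / 2 * pderivY f (x, y))) := by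
  have hxI : x ∈ Set.Icc (0 : ℝ) 1 := ⟨hx.1.le, hx.2⟩
  have hyI : y ∈ Set.Icc (0 : ℝ) 1 := ⟨hy.1.le, hy.2⟩
  obtain ⟨c, hc⟩ := exists_taylor_two_unitSquare hf hxI hyI
  set a := pderivX f (x, y)
  set b := pderivY f (x, y)
  set A := pderivX (pderivX f) (x, y)
  set B := pderivY (pderivY f) (x, y)
  have hx1 := tendsto_bernMean_akrNode_sub hx
  have hy1 := tendsto_bernMean_akrNode_sub hy
  have hx2 := tendsto_bernMean_akrNode_sub_sq hx
  have hy2 := tendsto_bernMean_akrNode_sub_sq hy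
  have hfourth := (tendsto_bernMean_akrNode_sub_fourth hx).add
    (tendsto_bernMean_akrNode_sub_fourth hy)
  rw [add_zero] at hfourth
  have hcross := (hx1.mul hy1).mul (tendsto_one_div_atTop_nhds_zero_nat (𝕜 := ℝ))
  have hmain := ((((hx1.const_mul a).add (hy1.const_mul b)).add (hx2.const_mul (A / 2))).add
    (hy2.const_mul (B / 2))).add (hcross.const_mul c)
  set R : ℕ → ℕ → ℕ → ℝ := fun n k l => f (akrNode n k, akrNode n l)
    - (f (x, y) + a * (akrNode n k - x) + b * (akrNode n l - y) + A / 2 * (akrNode n k - x) ^ 2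
      + B / 2 * (akrNode n l - y) ^ 2 + c * ((akrNode n k - x) * (akrNode n l - y))) with hR
  have hrem : Tendsto (fun n : ℕ => n * bernMean n x (fun k => bernMean n y (R n k))) atTop
      (nhds 0) := by
    refine tendsto_zero_of_abs_le_eps_mul_add (add_nonneg
      (mul_nonneg hxI.1 (sub_nonneg.2 hxI.2)) (mul_nonneg hyI.1 (sub_nonneg.2 hyI.2)))
      (hx2.add hy2) hfourth fun ε hε => ?_
    obtain ⟨M, -, hM⟩ := hc ε hε
    refine ⟨M, ?_⟩
    filter_upwards [eventually_ge_atTop 2] with n hn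
    have h := abs_bernMean_le hxI fun k hk => abs_bernMean_le hyI fun l hl =>
      hM _ (akrNode_mem_Icc hn hk) _ (akrNode_mem_Icc hn hl)
    simp only [bernMean_add, bernMean_const_mul, bernMean_const] at h
    rw [abs_mul, Nat.abs_cast]
    calc _ ≤ (n : ℝ) * _ := mul_le_mul_of_nonneg_left h (Nat.cast_nonneg n)
      _ = _ := by ring
  have hlim := hmain.add hrem
  refine (hlim.congr' ?_).trans (le_of_eq ?_)
  · filter_upwards [eventually_ge_atTop 1] with n hn
    have hn0 : (n : ℝ) ≠ 0 := by exact_mod_cast (by omega : n ≠ 0)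
    have hexp : akr2Op n f x y = f (x, y) + a * bernMean n x (fun k => akrNode n k - x)
        + b * bernMean n y (fun l => akrNode n l - y)
        + A / 2 * bernMean n x (fun k => (akrNode n k - x) ^ 2)
        + B / 2 * bernMean n y (fun l => (akrNode n l - y) ^ 2)
        + c * (bernMean n x (fun k => akrNode n k - x) * bernMean n y (fun l => akrNode n l - y))
        + bernMean n x (fun k => bernMean n y (R n k)) := by
      have hfun : ∀ k l, f (akrNode n k, akrNode n l) = f (x, y) + a * (akrNode n k - x)
          + b * (akrNode n l - y) + A / 2 * (akrNode n k - x) ^ 2 + B / 2 * (akrNode n l - y) ^ 2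
          + c * ((akrNode n k - x) * (akrNode n l - y)) + R n k l := fun k l => by
        rw [hR]
        ring
      rw [akr2Op_eq_bernMean]
      simp only [hfun, bernMean_add, bernMean_const_mul, bernMean_mul_const, bernMean_const]
    rw [hexp]
    field_simp
    ring
  · congr 1
    ring
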